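/- Fix ρ₀ ≥ 0. The Legendre transform Ψ*_{ρ₀} is twice continuously differentiable on ℝ, with (Ψ*_{ρ₀})''(y) = −G((Φ')₊⁻¹(y + Φ'(ρ₀))) for all y ∈ ℝ, where G(s) = 1/Φ''(s) = s/P'(s) for s > 0 and G(0) = 0 (a continuous extension, since Φ''(s) → ∞ as s → 0⁺). In particular, Ψ*_{ρ₀}(0) = 0, (Ψ*_{ρ₀})'(0) = 0, and, when ρ₀ > 0, (Ψ*_{ρ₀})''(0) = −1/Φ''(ρ₀), while (Ψ*_{ρ₀})''(0) = 0 when ρ₀ = 0. -/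

import Mathlib

open MeasureTheory Filter Set

/-- Enthalpy derivative `Φ'(ρ) = ∫₀^ρ P'(s)/s ds`. -/
noncomputable def PhiD (P' : ℝ → ℝ) (ρ : ℝ) : ℝ := ∫ s in Set.Ioc (0:ℝ) ρ, P' s / s

/-- Enthalpy `Φ(ρ) = ∫₀^ρ Φ'(σ) dσ`. -/
noncomputable def Phi (P' : ℝ → ℝ) (ρ : ℝ) : ℝ := ∫ σ in Set.Ioc (0:ℝ) ρ, PhiD P' σ

/-- `H_{ρ₀,y}(τ) = Ψ_{ρ₀}(τ) - y τ` where `Ψ_{ρ₀}(τ) = Φ(τ+ρ₀) - Φ(ρ₀) - Φ'(ρ₀) τ`. -/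
noncomputable def Hfun (P' : ℝ → ℝ) (ρ₀ y τ : ℝ) : ℝ :=
  (Phi P' (τ + ρ₀) - Phi P' ρ₀ - PhiD P' ρ₀ * τ) - y * τ

/-- Legendre transform `Ψ*_{ρ₀}(y) = inf_{τ ≥ -ρ₀} H_{ρ₀,y}(τ)`. -/
noncomputable def PsiStar (P' : ℝ → ℝ) (ρ₀ y : ℝ) : ℝ :=
  sInf (Hfun P' ρ₀ y '' Set.Ici (-ρ₀))

/-- `G(s) = 1/Φ''(s) = s/P'(s)` for `s > 0`, extended continuously by `G(s) = 0` for `s ≤ 0`. -/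
noncomputable def Gfun (P' : ℝ → ℝ) (s : ℝ) : ℝ := if s ≤ 0 then 0 else s / P' s

/-- The integrand `P'(s)/s` cut off to `(0,∞)`. -/
noncomputable def enthalpyDensity (P' : ℝ → ℝ) : ℝ → ℝ :=
  (Ioi (0:ℝ)).indicator (fun s => P' s / s)

lemma intervalIntegral_eq_setIntegral_of_eqOn_zero {f : ℝ → ℝ} (hf : ∀ s ≤ 0, f s = 0) (ρ : ℝ) :
    ∫ s in (0:ℝ)..ρ, f s = ∫ s in Ioc (0:ℝ) ρ, f s := by
  rcases le_total 0 ρ with h | h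
  · exact intervalIntegral.integral_of_le h
  · rw [Ioc_eq_empty (not_lt.mpr h), Measure.restrict_empty, integral_zero_measure,
      intervalIntegral.integral_symm, intervalIntegral.integral_of_le h,
      setIntegral_congr_fun (g := fun _ => (0:ℝ)) measurableSet_Ioc (fun s hs => hf s hs.2)]
    simp

lemma PhiD_eq_intervalIntegral (P' : ℝ → ℝ) (ρ : ℝ) :
    PhiD P' ρ = ∫ s in (0:ℝ)..ρ, enthalpyDensity P' s := by
  rw [intervalIntegral_eq_setIntegral_of_eqOn_zero
    (f := enthalpyDensity P') (fun s hs => indicator_of_notMem (not_lt.mpr hs) _)]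
  exact setIntegral_congr_fun measurableSet_Ioc
    (fun s hs => (indicator_of_mem (s := Ioi (0:ℝ)) hs.1 _).symm)

lemma PhiD_of_nonpos (P' : ℝ → ℝ) {ρ : ℝ} (h : ρ ≤ 0) : PhiD P' ρ = 0 := by
  rw [PhiD, Ioc_eq_empty (not_lt.mpr h), Measure.restrict_empty, integral_zero_measure]

lemma Phi_eq_intervalIntegral (P' : ℝ → ℝ) (ρ : ℝ) :
    Phi P' ρ = ∫ s in (0:ℝ)..ρ, PhiD P' s :=
  (intervalIntegral_eq_setIntegral_of_eqOn_zero (fun _ hs => PhiD_of_nonpos P' hs) ρ).symm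

lemma integrableOn_Ioc_div {P' : ℝ → ℝ} (hP'cont : ContinuousOn P' (Ioi 0)) {γ K : ℝ} (hγ : 1 < γ)
    (hlim : Tendsto (fun s => s ^ (1 - γ) * P' s) (nhdsWithin 0 (Ioi 0)) (nhds K)) (ρ : ℝ) :
    IntegrableOn (fun s => P' s / s) (Ioc 0 ρ) := by
  have hcont : ContinuousOn (fun s => P' s / s) (Ioi 0) :=
    hP'cont.div continuousOn_id (fun s hs => ne_of_gt hs)
  obtain ⟨δ, hδ, hbd⟩ : ∃ δ > (0:ℝ), ∀ s ∈ Ioc 0 δ, |s ^ (1 - γ) * P' s| ≤ |K| + 1 := by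
    have h := hlim.abs.eventually_le_const (lt_add_one |K|)
    obtain ⟨δ, hδ, h⟩ := mem_nhdsGT_iff_exists_Ioc_subset.mp h
    exact ⟨δ, hδ, fun s hs => h hs⟩
  have hnear : IntegrableOn (fun s => P' s / s) (Ioc 0 δ) := by
    have hpow : IntegrableOn (fun s : ℝ => (|K| + 1) * s ^ (γ - 2)) (Ioc 0 δ) :=
      ((intervalIntegrable_iff_integrableOn_Ioc_of_le hδ.le).mp
        (intervalIntegral.intervalIntegrable_rpow' (by linarith))).const_mul _
    refine hpow.mono' ((hcont.mono Ioc_subset_Ioi_self).aestronglyMeasurable measurableSet_Ioc) ?_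
    refine (ae_restrict_iff' measurableSet_Ioc).mpr (Eventually.of_forall fun s hs => ?_)
    have hs0 : 0 < s := hs.1
    have hfactor : P' s / s = (s ^ (1 - γ) * P' s) * s ^ (γ - 2) := by
      rw [mul_right_comm, ← Real.rpow_add hs0, show 1 - γ + (γ - 2) = (-1:ℝ) by ring,
        Real.rpow_neg_one, div_eq_inv_mul]
    have hpos : 0 < s ^ (γ - 2) := Real.rpow_pos_of_pos hs0 _
    rw [hfactor, Real.norm_eq_abs, abs_mul, abs_of_pos hpos]
    exact mul_le_mul_of_nonneg_right (hbd s hs) hpos.le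
  have hfar : IntegrableOn (fun s => P' s / s) (Icc δ ρ) :=
    (hcont.mono fun s hs => lt_of_lt_of_le hδ hs.1).integrableOn_Icc
  refine (hnear.union hfar).mono_set fun s hs => ?_
  rcases le_total s δ with h | h
  · exact Or.inl ⟨hs.1, h⟩
  · exact Or.inr ⟨h, hs.2⟩

lemma intervalIntegrable_enthalpyDensity {P' : ℝ → ℝ}
    (hint : ∀ ρ, IntegrableOn (fun s => P' s / s) (Ioc 0 ρ)) (a b : ℝ) :
    IntervalIntegrable (enthalpyDensity P') volume a b := by
  rw [intervalIntegrable_iff, enthalpyDensity, integrableOn_indicator_iff measurableSet_Ioi]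
  exact (hint (max a b)).mono_set fun s hs => ⟨hs.1, hs.2.2⟩

lemma continuous_PhiD {P' : ℝ → ℝ}
    (hint : ∀ ρ, IntegrableOn (fun s => P' s / s) (Ioc 0 ρ)) : Continuous (PhiD P') := by
  rw [funext (PhiD_eq_intervalIntegral P')]
  exact intervalIntegral.continuous_primitive (intervalIntegrable_enthalpyDensity hint) 0

lemma hasDerivAt_PhiD {P' : ℝ → ℝ} (hP'cont : ContinuousOn P' (Ioi 0))
    (hint : ∀ ρ, IntegrableOn (fun s => P' s / s) (Ioc 0 ρ)) {ρ : ℝ} (hρ : 0 < ρ) :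
    HasDerivAt (PhiD P') (P' ρ / ρ) ρ := by
  have hcont : ContinuousOn (enthalpyDensity P') (Ioi 0) :=
    (hP'cont.div continuousOn_id (fun s hs => ne_of_gt hs)).congr
      (fun s hs => indicator_of_mem hs _)
  rw [funext (PhiD_eq_intervalIntegral P')]
  have h := intervalIntegral.integral_hasDerivAt_right
    (intervalIntegrable_enthalpyDensity hint 0 ρ)
    (hcont.stronglyMeasurableAtFilter isOpen_Ioi ρ hρ) (hcont.continuousAt (Ioi_mem_nhds hρ))
  rwa [enthalpyDensity, indicator_of_mem (s := Ioi (0:ℝ)) hρ] at h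

lemma strictMonoOn_PhiD {P' : ℝ → ℝ} (hP'cont : ContinuousOn P' (Ioi 0))
    (hP'pos : ∀ s, 0 < s → 0 < P' s)
    (hint : ∀ ρ, IntegrableOn (fun s => P' s / s) (Ioc 0 ρ)) :
    StrictMonoOn (PhiD P') (Ici 0) := by
  refine strictMonoOn_of_deriv_pos (convex_Ici 0) (continuous_PhiD hint).continuousOn ?_
  intro s hs
  rw [interior_Ici] at hs
  rw [(hasDerivAt_PhiD hP'cont hint hs).deriv]
  exact div_pos (hP'pos s hs) hs

lemma hasDerivAt_Phi {P' : ℝ → ℝ} (hcont : Continuous (PhiD P')) (ρ : ℝ) :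
    HasDerivAt (Phi P') (PhiD P' ρ) ρ := by
  rw [funext (Phi_eq_intervalIntegral P')]
  exact hcont.integral_hasStrictDerivAt 0 ρ |>.hasDerivAt

/-- The tangent line inequality for the convex function `Φ`. -/
lemma Phi_add_PhiD_mul_sub_le {P' : ℝ → ℝ} (hcont : Continuous (PhiD P'))
    (hmono : StrictMonoOn (PhiD P') (Ici 0)) {r s : ℝ} (hr : 0 ≤ r) (hs : 0 ≤ s) :
    Phi P' s + PhiD P' s * (r - s) ≤ Phi P' r := by
  have hmvt : ∀ a b, a < b → ∃ c ∈ Ioo a b, Phi P' b - Phi P' a = PhiD P' c * (b - a) := by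
    intro a b hab
    obtain ⟨c, hc, h⟩ := exists_hasDerivAt_eq_slope (Phi P') (PhiD P') hab
      (fun x _ => (hasDerivAt_Phi hcont x).continuousAt.continuousWithinAt)
      (fun x _ => hasDerivAt_Phi hcont x)
    exact ⟨c, hc, by rw [h, div_mul_cancel₀ _ (sub_pos.mpr hab).ne']⟩
  rcases lt_trichotomy r s with h | rfl | h
  · obtain ⟨c, hc, hslope⟩ := hmvt r s h
    have hle := hmono (hr.trans hc.1.le) hs hc.2
    nlinarith [mul_nonneg (sub_nonneg.mpr hle.le) (sub_nonneg.mpr h.le)]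
  · simp
  · obtain ⟨c, hc, hslope⟩ := hmvt s r h
    have hle := hmono hs (hs.trans hc.1.le) hc.1
    nlinarith [mul_nonneg (sub_nonneg.mpr hle.le) (sub_nonneg.mpr h.le)]

lemma continuous_Gfun {P' : ℝ → ℝ} (hP'cont : ContinuousOn P' (Ioi 0))
    (hP'pos : ∀ s, 0 < s → 0 < P' s) {γ K : ℝ} (hγ : γ < 2) (hK : 0 < K)
    (hlim : Tendsto (fun s => s ^ (1 - γ) * P' s) (nhdsWithin 0 (Ioi 0)) (nhds K)) :
    Continuous (Gfun P') := by
  have hzero : ∀ s ≤ 0, Gfun P' s = 0 := fun s hs => if_pos hs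
  have hdiv : ∀ s ∈ Ioi (0:ℝ), Gfun P' s = s / P' s := fun s hs => if_neg (not_le.mpr hs)
  refine continuous_iff_continuousAt.mpr fun s => ?_
  rcases lt_trichotomy s 0 with hs | rfl | hs
  · exact (continuousAt_const (y := (0:ℝ))).congr
      (eventually_of_mem (Iio_mem_nhds hs) fun x hx => (hzero x (le_of_lt hx)).symm)
  · rw [continuousAt_iff_continuous_left'_right', ContinuousWithinAt, ContinuousWithinAt,
      hzero 0 le_rfl]
    constructor
    · exact tendsto_const_nhds.congr'
        (eventually_of_mem self_mem_nhdsWithin fun x hx => (hzero x (le_of_lt hx)).symm)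
    · have hpow : Tendsto (fun s : ℝ => s ^ (2 - γ)) (nhdsWithin 0 (Ioi 0)) (nhds 0) := by
        have h := (Real.continuousAt_rpow_const 0 (2 - γ) (Or.inr (by linarith))).tendsto
        rw [Real.zero_rpow (by linarith)] at h
        exact h.mono_left nhdsWithin_le_nhds
      have hquot := hpow.div hlim hK.ne'
      rw [zero_div] at hquot
      refine hquot.congr' (eventually_of_mem self_mem_nhdsWithin fun x hx => ?_)
      have hx0 : 0 < x := hx
      have hsplit : x ^ (2 - γ) = x ^ (1 - γ) * x := by
        rw [← Real.rpow_add_one hx0.ne']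
        ring_nf
      simp only [Pi.div_apply]
      rw [hdiv x hx, hsplit, mul_div_mul_left _ _ (Real.rpow_pos_of_pos hx0 _).ne']
  · have hcont : ContinuousOn (fun s => s / P' s) (Ioi 0) :=
      continuousOn_id.div hP'cont (fun x hx => (hP'pos x hx).ne')
    exact (hcont.congr hdiv).continuousAt (Ioi_mem_nhds hs)

/-- The extended inverse of a function strictly increasing on `[0,∞)` is continuous. -/
lemma continuous_of_extended_inverse {F I : ℝ → ℝ} (hF : StrictMonoOn F (Ici 0)) (hF0 : F 0 = 0)
    (hneg : ∀ y ≤ 0, I y = 0) (hpos : ∀ y, 0 ≤ y → 0 ≤ I y ∧ F (I y) = y) : Continuous I := by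
  have hleft : ∀ r, 0 ≤ r → I (F r) = r := fun r hr => by
    have hFr : 0 ≤ F r := hF0 ▸ hF.monotoneOn self_mem_Ici hr hr
    exact hF.injOn (hpos _ hFr).1 hr (hpos _ hFr).2
  have hImono : Monotone I := by
    intro x y hxy
    rcases le_total x 0 with hx | hx
    · rw [hneg x hx]
      rcases le_total y 0 with hy | hy
      · rw [hneg y hy]
      · exact (hpos y hy).1
    · have hx' := hpos x hx
      have hy' := hpos y (hx.trans hxy)
      exact (hF.le_iff_le hx'.1 hy'.1).mp (by rwa [hx'.2, hy'.2])
  have hmono : Monotone fun y => I y + min y 0 :=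
    fun x y hxy => add_le_add (hImono hxy) (min_le_min_right 0 hxy)
  have hsurj : Function.Surjective fun y => I y + min y 0 := by
    intro r
    rcases le_total 0 r with hr | hr
    · have hFr : 0 ≤ F r := hF0 ▸ hF.monotoneOn self_mem_Ici hr hr
      exact ⟨F r, by simp [hleft r hr, hFr]⟩
    · exact ⟨r, by simp [hneg r hr, hr]⟩
  have h := (hmono.continuous_of_surjective hsurj).sub (continuous_id.min (continuous_const (y := (0:ℝ))))
  exact h.congr fun y => by simp

/-- A function with a continuous family of supergradients is differentiable. -/
lemma hasDerivAt_of_supergradient {f g : ℝ → ℝ} (hg : Continuous g)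
    (h : ∀ y z, f z ≤ f y + g y * (z - y)) (y : ℝ) : HasDerivAt f (g y) y := by
  rw [hasDerivAt_iff_isLittleO, Asymptotics.isLittleO_iff]
  intro ε hε
  filter_upwards [Metric.continuous_iff'.mp hg y ε hε] with z hz
  rw [Real.dist_eq] at hz
  have hupper := h y z
  have hlower := h z y
  have hprod : |(g z - g y) * (z - y)| ≤ ε * |z - y| := by
    rw [abs_mul]
    exact mul_le_mul_of_nonneg_right hz.le (abs_nonneg _)
  have hbelow := (abs_le.mp hprod).1
  rw [Real.norm_eq_abs, Real.norm_eq_abs, smul_eq_mul]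
  refine abs_le.mpr ⟨by nlinarith, ?_⟩
  have := mul_nonneg hε.le (abs_nonneg (z - y))
  nlinarith

theorem stmt3 (P P' : ℝ → ℝ)
    (hP : ∀ s, 0 < s → HasDerivAt P (P' s) s)
    (hP'cont : ContinuousOn P' (Set.Ioi 0))
    (hP'pos : ∀ s, 0 < s → 0 < P' s)
    (γ₀ K₀ : ℝ) (hγ₀ : γ₀ ∈ Set.Ioo (6/5 : ℝ) 2) (hK₀ : 0 < K₀)
    (hlim₀ : Filter.Tendsto (fun s => s ^ (1 - γ₀) * P' s) (nhdsWithin 0 (Set.Ioi 0)) (nhds K₀))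
    (γ₁ K₁ : ℝ) (hγ₁ : γ₁ ∈ Set.Ioo (6/5 : ℝ) 2) (hK₁ : 0 < K₁)
    (hlim₁ : Filter.Tendsto (fun s => s ^ (1 - γ₁) * P' s) Filter.atTop (nhds K₁))
    -- `invPhi` is the extended inverse `(Φ')₊⁻¹ : ℝ → [0,∞)`, vanishing on `(-∞,0]`
    (invPhi : ℝ → ℝ)
    (hinv0 : ∀ y ≤ (0:ℝ), invPhi y = 0)
    (hinv : ∀ y, 0 ≤ y → 0 ≤ invPhi y ∧ PhiD P' (invPhi y) = y)
    (ρ₀ : ℝ) (hρ₀ : 0 ≤ ρ₀) :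
    -- `Ψ*_{ρ₀}` is C² on ℝ with `(Ψ*_{ρ₀})''(y) = -G((Φ')₊⁻¹(y + Φ'(ρ₀)))`
    ∃ D1 : ℝ → ℝ,
      Continuous D1 ∧
      Continuous (fun y : ℝ => -(Gfun P' (invPhi (y + PhiD P' ρ₀)))) ∧
      (∀ y : ℝ, HasDerivAt (PsiStar P' ρ₀) (D1 y) y) ∧
      (∀ y : ℝ, HasDerivAt D1 (-(Gfun P' (invPhi (y + PhiD P' ρ₀)))) y) ∧
      PsiStar P' ρ₀ 0 = 0 ∧
      D1 0 = 0 ∧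
      (0 < ρ₀ → -(Gfun P' (invPhi ((0:ℝ) + PhiD P' ρ₀))) = -(1 / (P' ρ₀ / ρ₀))) ∧
      (ρ₀ = 0 → -(Gfun P' (invPhi ((0:ℝ) + PhiD P' ρ₀))) = 0) := by
  have hint := integrableOn_Ioc_div hP'cont (by linarith [hγ₀.1]) hlim₀
  have hcont := continuous_PhiD hint
  have hmono := strictMonoOn_PhiD hP'cont hP'pos hint
  have hPhiD0 : PhiD P' 0 = 0 := PhiD_of_nonpos P' le_rfl
  have hPhiDρ₀ : 0 ≤ PhiD P' ρ₀ := hPhiD0 ▸ hmono.monotoneOn self_mem_Ici hρ₀ hρ₀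
  have hinvcont : Continuous invPhi := continuous_of_extended_inverse hmono hPhiD0 hinv0 hinv
  have hinvnonneg : ∀ y, 0 ≤ invPhi y := fun y => by
    rcases le_total y 0 with hy | hy
    · exact (hinv0 y hy).ge
    · exact (hinv y hy).1
  have hinvρ₀ : invPhi (PhiD P' ρ₀) = ρ₀ :=
    hmono.injOn (hinv _ hPhiDρ₀).1 hρ₀ (hinv _ hPhiDρ₀).2
  have hGcont : Continuous fun y => Gfun P' (invPhi y) :=
    (continuous_Gfun hP'cont hP'pos hγ₀.2 hK₀ hlim₀).comp hinvcont
  have hinvderiv : ∀ y, HasDerivAt invPhi (Gfun P' (invPhi y)) y := by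
    have hne : ∀ y ≠ 0, HasDerivAt invPhi (Gfun P' (invPhi y)) y := by
      intro y hy
      rcases lt_or_gt_of_ne hy with hy | hy
      · rw [hinv0 y hy.le, Gfun, if_pos le_rfl]
        exact (hasDerivAt_const y (0:ℝ)).congr_of_eventuallyEq
          (eventually_of_mem (Iio_mem_nhds hy) fun x hx => hinv0 x (le_of_lt hx))
      · have hpos : 0 < invPhi y := by
          refine lt_of_le_of_ne (hinv y hy.le).1 fun h => hy.ne ?_
          rw [← (hinv y hy.le).2, ← h, hPhiD0]
        rw [Gfun, if_neg (not_le.mpr hpos), ← inv_div]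
        exact HasDerivAt.of_local_left_inverse hinvcont.continuousAt
          (hasDerivAt_PhiD hP'cont hint hpos) (div_pos (hP'pos _ hpos) hpos).ne'
          (eventually_of_mem (Ioi_mem_nhds hy) fun x hx => (hinv x (le_of_lt hx)).2)
    intro y
    rcases eq_or_ne y 0 with rfl | hy
    · exact hasDerivAt_of_hasDerivAt_of_ne hne hinvcont.continuousAt hGcont.continuousAt
    · exact hne y hy
  have hmin : ∀ c r, 0 ≤ r → Phi P' (invPhi c) + c * (r - invPhi c) ≤ Phi P' r := by
    intro c r hr
    rcases le_total 0 c with hc | hc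
    · have h := Phi_add_PhiD_mul_sub_le hcont hmono hr (hinv c hc).1
      rwa [(hinv c hc).2] at h
    · have h := Phi_add_PhiD_mul_sub_le hcont hmono hr le_rfl
      rw [hPhiD0] at h
      rw [hinv0 c hc]
      nlinarith [mul_nonneg (neg_nonneg.mpr hc) hr]
  have hleast : ∀ y, IsLeast (Hfun P' ρ₀ y '' Ici (-ρ₀))
      (Hfun P' ρ₀ y (invPhi (y + PhiD P' ρ₀) - ρ₀)) := by
    intro y
    refine ⟨mem_image_of_mem _ (mem_Ici.mpr (by linarith [hinvnonneg (y + PhiD P' ρ₀)])), ?_⟩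
    rintro _ ⟨τ, hτ, rfl⟩
    have h := hmin (y + PhiD P' ρ₀) (τ + ρ₀) (by linarith [mem_Ici.mp hτ])
    simp only [Hfun, sub_add_cancel]
    linarith
  have hvalue : ∀ y, PsiStar P' ρ₀ y = Hfun P' ρ₀ y (invPhi (y + PhiD P' ρ₀) - ρ₀) :=
    fun y => (hleast y).csInf_eq
  have hshift : ∀ y, HasDerivAt (fun y => ρ₀ - invPhi (y + PhiD P' ρ₀))
      (-(Gfun P' (invPhi (y + PhiD P' ρ₀)))) y := fun y =>
    ((hinvderiv (y + PhiD P' ρ₀)).comp_add_const y (PhiD P' ρ₀)).const_sub ρ₀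
  have hD1cont : Continuous fun y => ρ₀ - invPhi (y + PhiD P' ρ₀) :=
    continuous_iff_continuousAt.mpr fun y => (hshift y).continuousAt
  refine ⟨fun y => ρ₀ - invPhi (y + PhiD P' ρ₀), hD1cont,
    (hGcont.comp (continuous_id.add continuous_const)).neg,
    hasDerivAt_of_supergradient hD1cont fun y z => ?_, hshift, ?_, ?_, fun h => ?_, fun h => ?_⟩
  · have h := (hleast z).2 (mem_image_of_mem _ (mem_Ici.mpr
      (show -ρ₀ ≤ invPhi (y + PhiD P' ρ₀) - ρ₀ by linarith [hinvnonneg (y + PhiD P' ρ₀)])))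
    rw [← hvalue] at h
    refine h.trans (le_of_eq ?_)
    rw [hvalue y]
    simp only [Hfun]
    ring
  · rw [hvalue, zero_add, hinvρ₀]
    simp [Hfun]
  · simp [hinvρ₀]
  · rw [zero_add, hinvρ₀, Gfun, if_neg (not_le.mpr h), one_div_div]
  · rw [zero_add, hinvρ₀, Gfun, if_pos h.le, neg_zero]
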